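/- Let S be a maximal surface in three-dimensional Anti-de Sitter space with principal curvatures ±λ, and away from umbilical points let χ = −ln|λ|, so that Δ_S χ = 2(1 − e^{−2χ}) and the curvature of S is K = −1 + e^{−2χ}. Then for any smooth function g: (0,∞) → ℝ, the function ψ = e^{g(χ)}‖grad χ‖² satisfies the differential inequality Δ_S ψ ≥ a(χ)ψ² + b(χ)ψ + c(χ), where a(χ) = g″(χ)e^{−g(χ)}, b(χ) = 6g′(χ)(1 − e^{−2χ}) + (10e^{−2χ} − 2), and c(χ) = e^{g(χ)}(Δ_S χ)². -/

import Mathlib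

/-!
Common framework for formalizing "Maximal surfaces in Anti-de Sitter space, width of
convex hulls and quasiconformal extensions of quasisymmetric homeomorphisms" (A. Seppi).

Anti-de Sitter space is modeled projectively: `qform` is the bilinear form of
signature (2,2) on ℝ⁴, `AdS3` is the projectivization of its negative cone,
and spacelike surfaces are recorded through (lifts of) smooth spacelike embeddings
of ℝ² into the quadric {⟨x,x⟩ = -1} (the double cover of AdS³), together with a
future-directed unit normal field and the associated shape operator.
-/

noncomputable section

open Real Set Filter Topology

namespace AdSPaper

/-- The bilinear form of signature `(2,2)` on `ℝ⁴`. -/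
def qform (x y : Fin 4 → ℝ) : ℝ :=
  x 0 * y 0 + x 1 * y 1 - x 2 * y 2 - x 3 * y 3

/-- Quotient topology on a projectivization. -/
instance (K V : Type*) [DivisionRing K] [AddCommGroup V] [Module K V] [TopologicalSpace V] :
    TopologicalSpace (Projectivization K V) := by
  unfold Projectivization
  infer_instance

/-- Real projective 3-space. -/
abbrev RP3 := Projectivization ℝ (Fin 4 → ℝ)

/-- The real projective line. -/
abbrev RP1 := Projectivization ℝ (Fin 2 → ℝ)

/-- The point of `ℝP³` determined by a nonzero vector of `ℝ⁴`. -/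
def projPt (x : Fin 4 → ℝ) (hx : x ≠ 0) : RP3 := Projectivization.mk ℝ x hx

/-- Anti-de Sitter space: the projectivization of the negative cone of `qform`.
(The sign of `qform x x` does not depend on the chosen representative.) -/
def AdS3 : Set RP3 := {P | qform P.rep P.rep < 0}

/-- The boundary at infinity of Anti-de Sitter space: the projectivization of the null cone. -/
def bdryAdS3 : Set RP3 := {P | qform P.rep P.rep = 0}

/-- The nonzero lifts of a subset of `ℝP³`. -/
def lifts (Γ : Set RP3) : Set (Fin 4 → ℝ) :=
  {x | ∃ hx : x ≠ 0, projPt x hx ∈ Γ}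

/-- The (projective) convex hull of a set `Γ ⊆ ℝP³` contained in an affine chart:
the image of the convex hull of a coherent family of lifts of `Γ`, chosen on the positive
side of a linear hyperplane avoiding all lifts of `Γ` (i.e. an affine chart containing `Γ`). -/
def projConvexHull (Γ : Set RP3) : Set RP3 :=
  {P | ∃ L : (Fin 4 → ℝ) →ₗ[ℝ] ℝ, (∀ x ∈ lifts Γ, L x ≠ 0) ∧
      ∃ (y : Fin 4 → ℝ) (hy : y ≠ 0), projPt y hy = P ∧
        y ∈ convexHull ℝ {x | x ∈ lifts Γ ∧ 0 < L x}}

/-- The width of (the convex hull of) a set `Γ ⊆ ℝP³`: the supremum of the lengths of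
timelike geodesic segments `t ↦ [cos t • a + sin t • b]` contained in the convex hull of `Γ`. -/
def width (Γ : Set RP3) : ℝ :=
  sSup {T : ℝ | 0 ≤ T ∧ T < π ∧ ∃ a b : Fin 4 → ℝ,
      qform a a = -1 ∧ qform b b = -1 ∧ qform a b = 0 ∧
      ∀ t ∈ Icc (0 : ℝ) T, ∃ h : (Real.cos t • a + Real.sin t • b) ≠ 0,
        projPt (Real.cos t • a + Real.sin t • b) h ∈ projConvexHull Γ}

/-- Inverse hyperbolic cosine. -/
def arcosh (x : ℝ) : ℝ := Real.log (x + Real.sqrt (x ^ 2 - 1))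

/-! ### The projective line, cross-ratios and quasisymmetric homeomorphisms -/

/-- Determinant of a pair of vectors of ℝ². -/
def det2 (v w : Fin 2 → ℝ) : ℝ := v 0 * w 1 - v 1 * w 0

/-- The cross-ratio of a quadruple of points of `ℝP¹`, with the convention
`cr(z₁,z₂,z₃,z₄) = (z₄−z₁)(z₃−z₂)/((z₂−z₁)(z₃−z₄))`.  (The expression below is
invariant under rescaling of each of the four representatives.) -/
def crossRatio (z₁ z₂ z₃ z₄ : RP1) : ℝ :=
  (det2 z₄.rep z₁.rep * det2 z₃.rep z₂.rep) / (det2 z₂.rep z₁.rep * det2 z₃.rep z₄.rep)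

/-- The cyclic orientation invariant of a triple of points of `ℝP¹`
(for finite points `a,b,c` it equals `(a−b)(b−c)(c−a)` and its sign is scale invariant). -/
def tripleOrient (a b c : RP1) : ℝ :=
  det2 a.rep b.rep * det2 b.rep c.rep * det2 c.rep a.rep

/-- A map of `ℝP¹` is orientation-preserving if it preserves the cyclic orientation
of triples of points. -/
def OrientationPreserving (φ : RP1 → RP1) : Prop :=
  ∀ a b c : RP1, 0 < tripleOrient a b c → 0 < tripleOrient (φ a) (φ b) (φ c)

/-- The set of cross-ratio distortions `|ln |cr(φ(Q))||` of symmetric quadruples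
(`cr(Q) = -1`) under the map `φ`. -/
def crSet (φ : RP1 → RP1) : Set ℝ :=
  {r | ∃ z₁ z₂ z₃ z₄ : RP1, crossRatio z₁ z₂ z₃ z₄ = -1 ∧
      r = |Real.log (abs (crossRatio (φ z₁) (φ z₂) (φ z₃) (φ z₄)))|}

/-- The cross-ratio norm `‖φ‖_cr` of a circle map `φ`. -/
def crNorm (φ : RP1 → RP1) : ℝ := sSup (crSet φ)

/-- A quasisymmetric homeomorphism of `ℝP¹`: an orientation-preserving homeomorphism
with finite cross-ratio norm. -/
def Quasisymmetric (φ : RP1 ≃ₜ RP1) : Prop :=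
  OrientationPreserving ⇑φ ∧ BddAbove (crSet ⇑φ)

/-- The null vector of ℝ^{2,2} corresponding to the pair of lines `([v],[w]) ∈ ℝP¹ × ℝP¹`
under the standard identification of `∂∞AdS³` with `ℝP¹ × ℝP¹` (via the rank-one
2×2 matrix `v wᵀ`, identifying ℝ^{2,2} with 2×2 matrices with minus the determinant). -/
def toBoundary (v w : Fin 2 → ℝ) : Fin 4 → ℝ :=
  ![(v 0 * w 0 - v 1 * w 1) / 2, (v 0 * w 1 + v 1 * w 0) / 2,
    (v 0 * w 0 + v 1 * w 1) / 2, (v 0 * w 1 - v 1 * w 0) / 2]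

/-- The graph `gr(φ)` of a map `φ : ℝP¹ → ℝP¹`, as a curve in `∂∞AdS³ ⊆ ℝP³`. -/
def grGraph (φ : RP1 → RP1) : Set RP3 :=
  {P | ∃ (v w : Fin 2 → ℝ) (hv : v ≠ 0) (hw : w ≠ 0) (hx : toBoundary v w ≠ 0),
      projPt (toBoundary v w) hx = P ∧
      φ (Projectivization.mk ℝ v hv) = Projectivization.mk ℝ w hw}

/-! ### Spacelike and maximal surfaces in AdS³ -/

/-- The global timelike vector field `x ↦ (0,0,−x₄,x₃)` on the quadric, fixing the
time orientation of AdS³. -/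
def timeVec (x : Fin 4 → ℝ) : Fin 4 → ℝ := ![0, 0, -(x 3), x 2]

/-- A (lifted, parametrized) smooth spacelike embedded disc in AdS³: a smooth embedding
of ℝ² into the quadric `{⟨x,x⟩ = −1} ⊆ ℝ^{2,2}` (the double cover of AdS³), with spacelike
first fundamental form, together with its future-directed unit normal field and
the associated shape operator `B = ∇N`. -/
structure SpacelikeSurface where
  /-- the embedding of ℝ² into the quadric -/
  emb : (Fin 2 → ℝ) → (Fin 4 → ℝ)
  /-- the future-directed unit normal vector field -/
  normal : (Fin 2 → ℝ) → (Fin 4 → ℝ)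
  /-- the shape operator, in the coordinates of the parametrization -/
  shape : (Fin 2 → ℝ) → ((Fin 2 → ℝ) →ₗ[ℝ] (Fin 2 → ℝ))
  smooth_emb : ContDiff ℝ (⊤ : ℕ∞) emb
  smooth_normal : ContDiff ℝ (⊤ : ℕ∞) normal
  inj : Function.Injective emb
  on_quadric : ∀ y, qform (emb y) (emb y) = -1
  spacelike : ∀ y v, v ≠ 0 → 0 < qform (fderiv ℝ emb y v) (fderiv ℝ emb y v)
  normal_unit : ∀ y, qform (normal y) (normal y) = -1
  normal_orth_base : ∀ y, qform (normal y) (emb y) = 0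
  normal_orth : ∀ y v, qform (normal y) (fderiv ℝ emb y v) = 0
  normal_future : ∀ y, qform (normal y) (timeVec (emb y)) < 0
  shape_spec : ∀ y v, fderiv ℝ normal y v = fderiv ℝ emb y (shape y v)

namespace SpacelikeSurface

variable (S : SpacelikeSurface)

/-- A spacelike surface is maximal if its shape operator is traceless. -/
def IsMaximal : Prop := ∀ y, LinearMap.trace ℝ (Fin 2 → ℝ) (S.shape y) = 0

/-- The surface as a subset of `ℝP³` (i.e. of AdS³). -/
def proj : Set RP3 :=
  {P | ∃ (y : Fin 2 → ℝ) (h : S.emb y ≠ 0), projPt (S.emb y) h = P}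

/-- The asymptotic boundary `∂∞S` of the surface: the frontier `closure S \ S`. -/
def bdryAtInfinity : Set RP3 := closure S.proj \ S.proj

/-- The surface is entire if its frontier is contained in the boundary at
infinity of AdS³. -/
def IsEntire : Prop := S.bdryAtInfinity ⊆ bdryAdS3

/-- The nonnegative principal curvature `λ` at a point: for a maximal surface the
principal curvatures are `±λ` with `λ = √(−det B)`. -/
def lambdaAt (y : Fin 2 → ℝ) : ℝ := Real.sqrt (-(LinearMap.det (S.shape y)))

/-- The supremum `‖λ‖∞` of the principal curvatures of the surface. -/
def lambdaSup : ℝ := ⨆ y, S.lambdaAt y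

/-- Nonpositive curvature: by the Gauss equation `K = −1 + λ²`, this is `λ ≤ 1`. -/
def NonpositiveCurvature : Prop := ∀ y, S.lambdaAt y ≤ 1

/-- Uniformly negative curvature: `λ ≤ 1 − ε` for some `ε > 0`. -/
def UniformlyNegativeCurvature : Prop := ∃ ε > 0, ∀ y, S.lambdaAt y ≤ 1 - ε

/-- The set of non-umbilical points of a maximal surface (where `λ ≠ 0`). -/
def nonUmbilic : Set (Fin 2 → ℝ) := {y | LinearMap.det (S.shape y) ≠ 0}

/-- The intrinsic distance of the induced Riemannian metric on the surface. -/
def idist (y₁ y₂ : Fin 2 → ℝ) : ℝ :=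
  sInf {L | ∃ c : ℝ → (Fin 2 → ℝ), ContDiff ℝ (⊤ : ℕ∞) c ∧ c 0 = y₁ ∧ c 1 = y₂ ∧
      L = ∫ t in (0:ℝ)..(1:ℝ),
        Real.sqrt (qform (deriv (fun s => S.emb (c s)) t) (deriv (fun s => S.emb (c s)) t))}

/-- `F` is the intrinsic gradient field of the function `f` on `U ⊆ S`: the vector field
which is `I`-dual to the differential of `f`. -/
def IsGradientOn (U : Set (Fin 2 → ℝ)) (f : (Fin 2 → ℝ) → ℝ)
    (F : (Fin 2 → ℝ) → (Fin 2 → ℝ)) : Prop :=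
  ∀ y ∈ U, ∀ v, qform (fderiv ℝ S.emb y (F y)) (fderiv ℝ S.emb y v) = fderiv ℝ f y v

/-- `H` is the intrinsic Hessian (as a (1,1)-tensor) of a function with gradient field `F`
on `U ⊆ S`: the tangential part of the ambient flat derivative of the ambient gradient
field (the normal part, in the ambient coordinates, lies in `span{σ(y), N(y)}`). -/
def IsHessianOn (U : Set (Fin 2 → ℝ)) (F : (Fin 2 → ℝ) → (Fin 2 → ℝ))
    (H : (Fin 2 → ℝ) → ((Fin 2 → ℝ) →ₗ[ℝ] (Fin 2 → ℝ))) : Prop :=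
  ∀ y ∈ U, ∀ v, ∃ a b : ℝ,
    fderiv ℝ (fun y' => fderiv ℝ S.emb y' (F y')) y v
      = fderiv ℝ S.emb y (H y v) + a • S.emb y + b • S.normal y

/-- The squared norm `‖grad f‖²` of a gradient field `F`, for the induced metric. -/
def gradNormSq (F : (Fin 2 → ℝ) → (Fin 2 → ℝ)) (y : Fin 2 → ℝ) : ℝ :=
  qform (fderiv ℝ S.emb y (F y)) (fderiv ℝ S.emb y (F y))

/-- `Δf` is the Laplace–Beltrami operator of the induced metric applied to `f`, on `U`:
the trace of the intrinsic Hessian. -/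
def IsLaplacianOn (U : Set (Fin 2 → ℝ)) (f Δf : (Fin 2 → ℝ) → ℝ) : Prop :=
  ∃ F H, S.IsGradientOn U f F ∧ S.IsHessianOn U F H ∧
    ∀ y ∈ U, Δf y = LinearMap.trace ℝ (Fin 2 → ℝ) (H y)

/-- `c` parametrizes an intrinsic geodesic of the surface: the ambient acceleration
is orthogonal to the surface, i.e. lies in `span{σ(c t), N(c t)}`. -/
def IsIntrinsicGeodesic (c : ℝ → (Fin 2 → ℝ)) : Prop :=
  ∀ t, ∃ a b : ℝ,
    deriv (deriv (fun s => S.emb (c s))) t = a • S.emb (c t) + b • S.normal (c t)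

/-- `E` is a system of normal coordinates for the surface centered at `y₀` (i.e. the
exponential map of the induced metric at that point, read in an orthonormal frame). -/
def IsNormalCoordsAt (y₀ : Fin 2 → ℝ) (E : (Fin 2 → ℝ) → (Fin 2 → ℝ)) : Prop :=
  E 0 = y₀ ∧ (∀ v, S.IsIntrinsicGeodesic (fun t => E (t • v))) ∧
  ∀ v w : Fin 2 → ℝ,
    qform (deriv (fun t : ℝ => S.emb (E (t • v))) 0) (deriv (fun t : ℝ => S.emb (E (t • w))) 0)
      = v 0 * w 0 + v 1 * w 1

end SpacelikeSurface

/-- The normal flow at time `ρ`: the parametrization of the surface `S_ρ` at constant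
timelike distance `ρ` from `S`. -/
def parallelEmb (S : SpacelikeSurface) (ρ : ℝ) : (Fin 2 → ℝ) → (Fin 4 → ℝ) :=
  fun y => Real.cos ρ • S.emb y + Real.sin ρ • S.normal y

/-- The pull-back to `S` of the first fundamental form of the parallel surface `S_ρ`. -/
def Irho (S : SpacelikeSurface) (ρ : ℝ) (y : Fin 2 → ℝ) (v w : Fin 2 → ℝ) : ℝ :=
  qform (fderiv ℝ (parallelEmb S ρ) y v) (fderiv ℝ (parallelEmb S ρ) y w)

/-- The second fundamental form of the parallel surface `S_ρ`, via `II_ρ = ½ dI_ρ/dρ`. -/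
def IIrho (S : SpacelikeSurface) (ρ : ℝ) (y : Fin 2 → ℝ) (v w : Fin 2 → ℝ) : ℝ :=
  (1 / 2) * deriv (fun ρ' => Irho S ρ' y v w) ρ

/-! ### Euclidean balls and `C⁰`/`C²` norms on ℝ² -/

/-- The Euclidean ball of radius `r` centered at the origin of ℝ². -/
def eball (r : ℝ) : Set (Fin 2 → ℝ) := {z | Real.sqrt ((z 0) ^ 2 + (z 1) ^ 2) < r}

/-- The `C⁰` norm of a function on the Euclidean ball of radius `r`. -/
def C0norm (u : (Fin 2 → ℝ) → ℝ) (r : ℝ) : ℝ :=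
  sSup {a | ∃ z ∈ eball r, a = |u z|}

/-- The `C²` norm of a function on the Euclidean ball of radius `r`. -/
def C2norm (u : (Fin 2 → ℝ) → ℝ) (r : ℝ) : ℝ :=
  sSup {a | ∃ z ∈ eball r, a = |u z| + ‖fderiv ℝ u z‖ + ‖fderiv ℝ (fderiv ℝ u) z‖}

end AdSPaper

namespace AdSPaper

/-- The function `χ = −ln λ` on (the non-umbilical part of) a maximal surface. -/
def chiFun (S : SpacelikeSurface) (y : Fin 2 → ℝ) : ℝ := -Real.log (S.lambdaAt y)

open VectorField

/-! ### The bilinear form -/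

/-- `qform` as a continuous bilinear map. -/
def qformL : (Fin 4 → ℝ) →L[ℝ] (Fin 4 → ℝ) →L[ℝ] ℝ :=
  LinearMap.toContinuousBilinearMap
    (LinearMap.mk₂ ℝ qform
      (fun x x' y => by simp only [qform, Pi.add_apply]; ring)
      (fun c x y => by simp only [qform, Pi.smul_apply, smul_eq_mul]; ring)
      (fun x y y' => by simp only [qform, Pi.add_apply]; ring)
      (fun c x y => by simp only [qform, Pi.smul_apply, smul_eq_mul]; ring))

lemma qformL_apply (x y : Fin 4 → ℝ) : qformL x y = qform x y := rfl

lemma qform_comm (x y : Fin 4 → ℝ) : qform x y = qform y x := by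
  simp only [qform]; ring

lemma qform_add_left (x x' y : Fin 4 → ℝ) : qform (x + x') y = qform x y + qform x' y := by
  simp only [qform, Pi.add_apply]; ring

lemma qform_add_right (x y y' : Fin 4 → ℝ) : qform x (y + y') = qform x y + qform x y' := by
  simp only [qform, Pi.add_apply]; ring

lemma qform_smul_left (c : ℝ) (x y : Fin 4 → ℝ) : qform (c • x) y = c * qform x y := by
  simp only [qform, Pi.smul_apply, smul_eq_mul]; ring

lemma qform_smul_right (c : ℝ) (x y : Fin 4 → ℝ) : qform x (c • y) = c * qform x y := by
  simp only [qform, Pi.smul_apply, smul_eq_mul]; ring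

/-- Expansion of `qform` in an orthogonal frame of signature `(2,2)`. -/
lemma qform_eq_of_orthogonal {X Y s N : Fin 4 → ℝ} {r : ℝ} (hr : r ≠ 0)
    (hXX : qform X X = r) (hYY : qform Y Y = r) (hXY : qform X Y = 0)
    (hss : qform s s = -1) (hNN : qform N N = -1) (hNs : qform N s = 0)
    (hsX : qform s X = 0) (hsY : qform s Y = 0) (hNX : qform N X = 0) (hNY : qform N Y = 0)
    (u v : Fin 4 → ℝ) :
    qform u v = r⁻¹ * (qform u X * qform v X + qform u Y * qform v Y)
      - qform u s * qform v s - qform u N * qform v N := by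
  simp only [qform] at *
  let A : Matrix (Fin 4) (Fin 4) ℝ :=
    !![X 0, X 1, -X 2, -X 3; Y 0, Y 1, -Y 2, -Y 3; s 0, s 1, -s 2, -s 3; N 0, N 1, -N 2, -N 3]
  let B : Matrix (Fin 4) (Fin 4) ℝ :=
    !![r⁻¹ * X 0, r⁻¹ * Y 0, -s 0, -N 0; r⁻¹ * X 1, r⁻¹ * Y 1, -s 1, -N 1;
      r⁻¹ * X 2, r⁻¹ * Y 2, -s 2, -N 2; r⁻¹ * X 3, r⁻¹ * Y 3, -s 3, -N 3]
  have hri : r⁻¹ * r = 1 := inv_mul_cancel₀ hr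
  have hAB : A * B = 1 := by
    ext i j
    fin_cases i <;> fin_cases j <;>
      simp [A, B, Matrix.mul_apply, Fin.sum_univ_four] <;> grind
  have hBA : B * A = 1 := mul_eq_one_comm.mp hAB
  have huv : dotProduct (Matrix.vecMul ![u 0, u 1, -u 2, -u 3] (B * A)) v =
      dotProduct ![u 0, u 1, -u 2, -u 3] v := by
    rw [hBA, Matrix.vecMul_one]
  simp [A, B, Matrix.vecMul, dotProduct, Matrix.mul_apply, Fin.sum_univ_four] at huv
  linear_combination -huv

/-! ### Differentiation along vector fields -/

section Calculus

variable {E : Type*} [NormedAddCommGroup E] [NormedSpace ℝ E]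

/-- The derivative of `f` along the vector field `X`. -/
def alongD (X : (Fin 2 → ℝ) → (Fin 2 → ℝ)) (f : (Fin 2 → ℝ) → E) : (Fin 2 → ℝ) → E :=
  fun y => fderiv ℝ f y (X y)

/-- Smoothness on a set. -/
abbrev SmoothOn (W : Set (Fin 2 → ℝ)) (f : (Fin 2 → ℝ) → E) : Prop :=
  ContDiffOn ℝ (⊤ : ℕ∞) f W

variable {W : Set (Fin 2 → ℝ)} {X : (Fin 2 → ℝ) → (Fin 2 → ℝ)} {y : Fin 2 → ℝ}

lemma SmoothOn.differentiableAt {f : (Fin 2 → ℝ) → E} (hf : SmoothOn W f) (hW : IsOpen W)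
    (hy : y ∈ W) : DifferentiableAt ℝ f y :=
  (hf.contDiffAt (hW.mem_nhds hy)).differentiableAt (by simp)

lemma SmoothOn.alongD {f : (Fin 2 → ℝ) → E} (hf : SmoothOn W f) (hW : IsOpen W)
    (hX : SmoothOn W X) : SmoothOn W (alongD X f) :=
  (hf.fderiv_of_isOpen hW (by simp)).clm_apply hX

lemma SmoothOn.qform {f h : (Fin 2 → ℝ) → (Fin 4 → ℝ)} (hf : SmoothOn W f)
    (hh : SmoothOn W h) : SmoothOn W (fun y => qform (f y) (h y)) :=
  (contDiffOn_const (c := qformL)).clm_apply hf |>.clm_apply hh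

lemma alongD_congr {f h : (Fin 2 → ℝ) → E} (hW : IsOpen W) (hfh : EqOn f h W) :
    EqOn (alongD X f) (alongD X h) W := fun y hy => by
  simp only [alongD]
  rw [(hfh.eventuallyEq_of_mem (hW.mem_nhds hy)).fderiv_eq]

lemma alongD_eq_zero_of_eqOn_const {f : (Fin 2 → ℝ) → E} {c : E} (hW : IsOpen W)
    (hf : ∀ y ∈ W, f y = c) (hy : y ∈ W) : alongD X f y = 0 := by
  rw [alongD_congr (h := fun _ => c) hW hf hy]
  simp [alongD]

lemma alongD_add {f h : (Fin 2 → ℝ) → E} (hf : DifferentiableAt ℝ f y)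
    (hh : DifferentiableAt ℝ h y) :
    alongD X (fun z => f z + h z) y = alongD X f y + alongD X h y := by
  simp [alongD, fderiv_fun_add hf hh]

lemma alongD_mul {f h : (Fin 2 → ℝ) → ℝ} (hf : DifferentiableAt ℝ f y)
    (hh : DifferentiableAt ℝ h y) :
    alongD X (fun z => f z * h z) y = alongD X f y * h y + f y * alongD X h y := by
  simp [alongD, fderiv_fun_mul hf hh]; ring

lemma alongD_smul {f : (Fin 2 → ℝ) → ℝ} {h : (Fin 2 → ℝ) → E} (hf : DifferentiableAt ℝ f y)
    (hh : DifferentiableAt ℝ h y) :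
    alongD X (fun z => f z • h z) y = alongD X f y • h y + f y • alongD X h y := by
  simp [alongD, fderiv_fun_smul hf hh, add_comm]

lemma alongD_comp {k : ℝ → ℝ} {f : (Fin 2 → ℝ) → ℝ} (hk : DifferentiableAt ℝ k (f y))
    (hf : DifferentiableAt ℝ f y) :
    alongD X (fun z => k (f z)) y = deriv k (f y) * alongD X f y := by
  have := (hk.hasDerivAt.comp_hasFDerivAt y hf.hasFDerivAt).fderiv
  simp only [alongD, Function.comp_def] at this ⊢
  rw [this]; simp

lemma alongD_qform {f h : (Fin 2 → ℝ) → (Fin 4 → ℝ)} (hf : DifferentiableAt ℝ f y)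
    (hh : DifferentiableAt ℝ h y) :
    alongD X (fun z => qform (f z) (h z)) y
      = qform (alongD X f y) (h y) + qform (f y) (alongD X h y) := by
  have := qformL.fderiv_of_bilinear hf hh
  simp only [qformL_apply] at this
  simp only [alongD, this]
  simp [qformL_apply, add_comm]

lemma alongD_lieBracket {f : (Fin 2 → ℝ) → E} {Y : (Fin 2 → ℝ) → (Fin 2 → ℝ)} (hW : IsOpen W)
    (hf : SmoothOn W f) (hX : SmoothOn W X) (hY : SmoothOn W Y) (hy : y ∈ W) :
    fderiv ℝ f y (lieBracket ℝ X Y y) = alongD X (alongD Y f) y - alongD Y (alongD X f) y :=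
  fderiv_apply_lieBracket (hf.contDiffAt (hW.mem_nhds hy)) (by simpa using ENat.LEInfty.out)
    (hY.differentiableAt hW hy) (hX.differentiableAt hW hy)

end Calculus

/-! ### The flat computation -/

section Flat

variable {W : Set (Fin 2 → ℝ)} {X Y : (Fin 2 → ℝ) → (Fin 2 → ℝ)} {y : Fin 2 → ℝ}

lemma alongD_comp_mul_sq_add_sq {k : ℝ → ℝ} (hk : ContDiff ℝ (⊤ : ℕ∞) k)
    {u p q : (Fin 2 → ℝ) → ℝ} (hW : IsOpen W)
    (hu : SmoothOn W u) (hp : SmoothOn W p) (hq : SmoothOn W q) (hy : y ∈ W) :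
    alongD X (fun z => k (u z) * (p z * p z + q z * q z)) y
      = deriv k (u y) * alongD X u y * (p y * p y + q y * q y)
        + k (u y) * (2 * p y * alongD X p y + 2 * q y * alongD X q y) := by
  have du := hu.differentiableAt hW hy
  have dp := hp.differentiableAt hW hy
  have dq := hq.differentiableAt hW hy
  have dk : DifferentiableAt ℝ k (u y) := hk.differentiable (by simp) _
  rw [alongD_mul (by exact dk.comp y du) (by fun_prop), alongD_comp dk du,
    alongD_add (by fun_prop) (by fun_prop), alongD_mul dp dp, alongD_mul dq dq]
  ring

/-- Second derivative along `X` of `k(u) (p² + q²)`. -/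
lemma alongD_alongD_comp_mul_sq_add_sq {k : ℝ → ℝ} (hk : ContDiff ℝ (⊤ : ℕ∞) k)
    {u p q : (Fin 2 → ℝ) → ℝ} (hW : IsOpen W) (hX : SmoothOn W X)
    (hu : SmoothOn W u) (hp : SmoothOn W p) (hq : SmoothOn W q) (hy : y ∈ W) :
    alongD X (alongD X (fun z => k (u z) * (p z * p z + q z * q z))) y
      = (deriv (deriv k) (u y) * alongD X u y ^ 2 + deriv k (u y) * alongD X (alongD X u) y)
          * (p y ^ 2 + q y ^ 2)
        + 4 * deriv k (u y) * alongD X u y * (p y * alongD X p y + q y * alongD X q y)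
        + 2 * k (u y) * (alongD X p y ^ 2 + alongD X q y ^ 2
          + p y * alongD X (alongD X p) y + q y * alongD X (alongD X q) y) := by
  have hk' : ContDiff ℝ (⊤ : ℕ∞) (deriv k) := by
    have : ContDiff ℝ ((⊤ : ℕ∞) + 1) k := by simpa using hk
    exact (contDiff_succ_iff_deriv.mp this).2.2
  rw [alongD_congr hW
    (fun z hz => alongD_comp_mul_sq_add_sq (X := X) hk hW hu hp hq hz) hy]
  have du := hu.differentiableAt hW hy
  have dp := hp.differentiableAt hW hy
  have dq := hq.differentiableAt hW hy
  have du' := (hu.alongD hW hX).differentiableAt hW hy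
  have dp' := (hp.alongD hW hX).differentiableAt hW hy
  have dq' := (hq.alongD hW hX).differentiableAt hW hy
  have dk : DifferentiableAt ℝ k (u y) := hk.differentiable (by simp) _
  have dk' : DifferentiableAt ℝ (deriv k) (u y) := hk'.differentiable (by simp) _
  have dku : DifferentiableAt ℝ (fun z => k (u z)) y := dk.comp y du
  have dku' : DifferentiableAt ℝ (fun z => deriv k (u z)) y := dk'.comp y du
  have hc : ∀ c : ℝ, alongD X (fun _ => c) y = 0 := fun c => by simp [alongD]
  rw [alongD_add (by fun_prop) (by fun_prop), alongD_mul (by fun_prop) (by fun_prop),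
    alongD_mul (by fun_prop) (by fun_prop), alongD_mul (by fun_prop) (by fun_prop),
    alongD_add (by fun_prop) (by fun_prop), alongD_add (by fun_prop) (by fun_prop),
    alongD_mul dp dp, alongD_mul dq dq, alongD_mul (by fun_prop) (by fun_prop),
    alongD_mul (by fun_prop) (by fun_prop),
    alongD_mul (by fun_prop) dq', alongD_mul (by fun_prop) dq, alongD_comp dk du, alongD_comp dk' du, hc]
  ring

lemma deriv_exp_sub_id {g : ℝ → ℝ} (hg : Differentiable ℝ g) :
    deriv (fun t => exp (g t - t)) = fun t => (deriv g t - 1) * exp (g t - t) := by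
  ext t
  have := (((hg t).hasDerivAt.sub (hasDerivAt_id t)).exp).deriv
  simp only [Pi.sub_apply, id] at this
  rw [mul_comm]
  exact this

lemma deriv_deriv_exp_sub_id {g : ℝ → ℝ} (hg : ContDiff ℝ (⊤ : ℕ∞) g) (t : ℝ) :
    deriv (deriv fun t => exp (g t - t)) t
      = (deriv (deriv g) t + (deriv g t - 1) ^ 2) * exp (g t - t) := by
  have hg' : ContDiff ℝ (⊤ : ℕ∞) (deriv g) := by
    have : ContDiff ℝ ((⊤ : ℕ∞) + 1) g := by simpa using hg
    exact (contDiff_succ_iff_deriv.mp this).2.2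
  have dg : Differentiable ℝ g := hg.differentiable (by simp)
  have dg' : Differentiable ℝ (deriv g) := hg'.differentiable (by simp)
  rw [deriv_exp_sub_id dg, deriv_fun_mul (by fun_prop) (by fun_prop), deriv_exp_sub_id dg,
    deriv_sub_const]
  ring

/-- The differential inequality in an orthogonal frame of commuting vector fields of squared
norm `exp u`, for a solution `u` of the sinh-Gordon equation. -/
lemma flat_differential_inequality {g : ℝ → ℝ} (hg : ContDiff ℝ (⊤ : ℕ∞) g)
    {u : (Fin 2 → ℝ) → ℝ} (hW : IsOpen W) (hX : SmoothOn W X) (hY : SmoothOn W Y)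
    (hu : SmoothOn W u)
    (hcomm : ∀ f : (Fin 2 → ℝ) → ℝ, SmoothOn W f →
      EqOn (alongD X (alongD Y f)) (alongD Y (alongD X f)) W)
    (hlap : ∀ z ∈ W, alongD X (alongD X u) z + alongD Y (alongD Y u) z
      = 2 * (exp (u z) - exp (-u z))) (hy : y ∈ W)
    {ψ : (Fin 2 → ℝ) → ℝ} {P : ℝ}
    (hψ : ψ = fun z => exp (g (u z) - u z)
      * (alongD X u z * alongD X u z + alongD Y u z * alongD Y u z))
    (hP : P = exp (-u y) * (alongD X u y ^ 2 + alongD Y u y ^ 2)) :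
    deriv (deriv g) (u y) * exp (-g (u y)) * (exp (g (u y)) * P) ^ 2
        + (6 * deriv g (u y) * (1 - exp (-(2 * u y))) + (10 * exp (-(2 * u y)) - 2))
          * (exp (g (u y)) * P)
        + exp (g (u y)) * (exp (-u y) * (alongD X (alongD X u) y + alongD Y (alongD Y u) y)) ^ 2
      ≤ exp (-u y) * (alongD X (alongD X ψ) y + alongD Y (alongD Y ψ) y) := by
  have hk : ContDiff ℝ (⊤ : ℕ∞) (fun t => exp (g t - t)) := by fun_prop
  have hu1 := hu.alongD hW hX
  have hu2 := hu.alongD hW hY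
  have dg : Differentiable ℝ g := hg.differentiable (by simp)
  have hexp : ∀ Z : (Fin 2 → ℝ) → (Fin 2 → ℝ),
      alongD Z (fun z => 2 * (exp (u z) - exp (-u z))) y
        = 2 * (exp (u y) + exp (-u y)) * alongD Z u y := fun Z => by
    have du := hu.differentiableAt hW hy
    have hd : deriv (fun t : ℝ => 2 * (exp t - exp (-t))) (u y)
        = 2 * (exp (u y) + exp (-u y)) := by
      have h1 := (((hasDerivAt_id (u y)).exp).sub ((hasDerivAt_id (u y)).neg.exp)).const_mul 2
      have h2 := h1.deriv
      simp only [Pi.sub_apply, Pi.neg_apply, id] at h2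
      rw [show (fun t : ℝ => 2 * (exp t - exp (-t))) = _ from rfl] at h2
      rw [h2]; ring
    rw [alongD_comp (k := fun t : ℝ => 2 * (exp t - exp (-t))) (by fun_prop) du, hd]
  have hthird : ∀ Z : (Fin 2 → ℝ) → (Fin 2 → ℝ),
      alongD Z (alongD X (alongD X u)) y + alongD Z (alongD Y (alongD Y u)) y
        = 2 * (exp (u y) + exp (-u y)) * alongD Z u y := fun Z => by
    rw [← hexp, ← alongD_congr hW hlap hy,
      alongD_add ((hu1.alongD hW hX).differentiableAt hW hy)
        ((hu2.alongD hW hY).differentiableAt hW hy)]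
  have h12 := hcomm u hu hy
  have hYYX : alongD Y (alongD Y (alongD X u)) y = alongD X (alongD Y (alongD Y u)) y := by
    rw [hcomm _ hu2 hy, alongD_congr hW (hcomm u hu) hy]
  have hXXY : alongD X (alongD X (alongD Y u)) y = alongD Y (alongD X (alongD X u)) y := by
    rw [← hcomm _ hu1 hy, alongD_congr hW (hcomm u hu) hy]
  have hX3 := hthird X
  have hY3 := hthird Y
  have hl := hlap y hy
  rw [hψ, alongD_alongD_comp_mul_sq_add_sq hk hW hX hu hu1 hu2 hy,
    alongD_alongD_comp_mul_sq_add_sq hk hW hY hu hu1 hu2 hy, deriv_deriv_exp_sub_id hg,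
    deriv_exp_sub_id dg, hP, hYYX, hXXY]
  have e1 : exp (g (u y) - u y) = exp (g (u y)) * exp (-u y) := by rw [← exp_add]; ring_nf
  have e2 : exp (-(2 * u y)) = exp (-u y) ^ 2 := by rw [← exp_nat_mul]; ring_nf
  have e3 : exp (-g (u y)) * exp (g (u y)) = 1 := by rw [← exp_add]; simp
  have e4 : exp (-u y) * exp (u y) = 1 := by rw [← exp_add]; simp
  have hG : 0 < exp (g (u y)) := exp_pos _
  beta_reduce
  rw [e1, e2]
  generalize exp (g (u y)) = G at *
  generalize exp (-g (u y)) = G' at *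
  generalize exp (-u y) = t at *
  generalize exp (u y) = r at *
  generalize alongD X (alongD X (alongD X u)) y = u111 at *
  generalize alongD Y (alongD Y (alongD Y u)) y = u222 at *
  generalize alongD X (alongD Y (alongD Y u)) y = u122 at *
  generalize alongD Y (alongD X (alongD X u)) y = u112 at *
  rw [h12]
  generalize alongD X (alongD X u) y = u11 at *
  generalize alongD Y (alongD Y u) y = u22 at *
  generalize alongD Y (alongD X u) y = u12 at *
  generalize alongD X u y = u1 at *
  generalize alongD Y u y = u2 at *
  generalize deriv (deriv g) (u y) = g2 at *
  generalize deriv g (u y) = g1 at *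
  have hpos : 0 ≤ G * t ^ 2 * ((u11 - u22 - (u1 ^ 2 - u2 ^ 2) + g1 * (u1 ^ 2 - u2 ^ 2)) ^ 2
      + (2 * (u12 - u1 * u2) + 2 * g1 * (u1 * u2)) ^ 2) := by positivity
  have h111 : u111 = 2 * (r + t) * u1 - u122 := by linarith
  have h222 : u222 = 2 * (r + t) * u2 - u112 := by linarith
  have h22 : u22 = 2 * (r - t) - u11 := by linarith
  subst h111 h222 h22
  refine le_of_sub_nonneg (hpos.trans_eq ?_)
  linear_combination g2 * G * (t * (u1 ^ 2 + u2 ^ 2)) ^ 2 * e3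
    - (6 * g1 - 2) * G * t * (u1 ^ 2 + u2 ^ 2) * e4

end Flat


/-! ### Conformal principal frames -/

/-- The vector fields `X, Y` form an orthogonal frame of principal directions on the open set `W`
of non-umbilical points, normalized to have squared norm `exp χ = 1 / λ`. -/
structure IsPrincipalFrame (S : SpacelikeSurface) (W : Set (Fin 2 → ℝ))
    (X Y : (Fin 2 → ℝ) → (Fin 2 → ℝ)) : Prop where
  isOpen : IsOpen W
  subset : W ⊆ S.nonUmbilic
  smooth_chi : SmoothOn W (chiFun S)
  smooth_left : SmoothOn W X
  smooth_right : SmoothOn W Y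
  norm_left : ∀ y ∈ W, qform (alongD X S.emb y) (alongD X S.emb y) = exp (chiFun S y)
  norm_right : ∀ y ∈ W, qform (alongD Y S.emb y) (alongD Y S.emb y) = exp (chiFun S y)
  orth : ∀ y ∈ W, qform (alongD X S.emb y) (alongD Y S.emb y) = 0
  shape_left : ∀ y ∈ W, S.shape y (X y) = exp (-chiFun S y) • X y
  shape_right : ∀ y ∈ W, S.shape y (Y y) = -(exp (-chiFun S y) • Y y)

namespace IsPrincipalFrame

variable {S : SpacelikeSurface} {W : Set (Fin 2 → ℝ)} {X Y : (Fin 2 → ℝ) → (Fin 2 → ℝ)}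
  {y : Fin 2 → ℝ}

lemma det_ne_zero (h : IsPrincipalFrame S W X Y) (hy : y ∈ W) :
    X y 0 * Y y 1 - X y 1 * Y y 0 ≠ 0 := by
  intro h0
  have e0 : Y y 0 • X y - X y 0 • Y y = 0 := by
    ext i; fin_cases i <;> simp <;> linarith
  have e1 : Y y 1 • X y - X y 1 • Y y = 0 := by
    ext i; fin_cases i <;> simp <;> linarith
  have key : ∀ a b : ℝ, a • X y - b • Y y = 0 → a = 0 := fun a b hab => by
    have := congrArg (fun v => qform (fderiv ℝ S.emb y v) (alongD X S.emb y)) hab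
    simp only [sub_eq_add_neg, ← neg_smul, map_add, map_smul, map_zero, qform_add_left,
      qform_smul_left] at this
    have h1 := h.norm_left y hy
    have h2 := h.orth y hy
    rw [qform_comm] at h2
    simp only [alongD] at this h1 h2
    rw [h1, h2] at this
    simpa [qform, (exp_pos _).ne'] using this
  have hY : Y y = 0 := by
    ext i; fin_cases i
    · exact key _ _ e0
    · exact key _ _ e1
  have := h.norm_right y hy
  simp only [alongD, hY, map_zero] at this
  exact (exp_pos _).ne (by simpa [qform] using this)

lemma exists_eq_smul_add_smul (h : IsPrincipalFrame S W X Y) (hy : y ∈ W) (v : Fin 2 → ℝ) :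
    ∃ a b : ℝ, v = a • X y + b • Y y := by
  have hd := h.det_ne_zero hy
  refine ⟨(v 0 * Y y 1 - v 1 * Y y 0) / (X y 0 * Y y 1 - X y 1 * Y y 0),
    (X y 0 * v 1 - X y 1 * v 0) / (X y 0 * Y y 1 - X y 1 * Y y 0), ?_⟩
  ext i
  fin_cases i <;> simp <;>
    rw [div_mul_eq_mul_div, div_mul_eq_mul_div, ← add_div, eq_div_iff hd] <;> ring

lemma trace_eq (h : IsPrincipalFrame S W X Y) (hy : y ∈ W)
    {L : (Fin 2 → ℝ) →ₗ[ℝ] (Fin 2 → ℝ)} {a b c d : ℝ}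
    (hX : L (X y) = a • X y + b • Y y) (hY : L (Y y) = c • X y + d • Y y) :
    LinearMap.trace ℝ (Fin 2 → ℝ) L = a + d := by
  have hdec : ∀ v : Fin 2 → ℝ, L v = v 0 • L (Pi.single 0 1) + v 1 • L (Pi.single 1 1) :=
    fun v => by
      rw [← map_smul, ← map_smul, ← map_add]
      congr 1
      ext i; fin_cases i <;> simp
  have htr : LinearMap.trace ℝ (Fin 2 → ℝ) L
      = L (Pi.single 0 1) 0 + L (Pi.single 1 1) 1 := by
    rw [LinearMap.trace_eq_matrix_trace ℝ (Pi.basisFun ℝ (Fin 2)), Matrix.trace_fin_two]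
    simp
  rw [htr]
  rw [hdec] at hX hY
  have hX0 := congrFun hX 0
  have hX1 := congrFun hX 1
  have hY0 := congrFun hY 0
  have hY1 := congrFun hY 1
  simp only [Pi.add_apply, Pi.smul_apply, smul_eq_mul] at hX0 hX1 hY0 hY1
  refine mul_left_cancel₀ (h.det_ne_zero hy) ?_
  linear_combination Y y 1 * hX0 - Y y 0 * hX1 - X y 1 * hY0 + X y 0 * hY1

lemma smooth_emb (_ : IsPrincipalFrame S W X Y) : SmoothOn W S.emb := S.smooth_emb.contDiffOn

lemma smooth_alongD_left {E : Type*} [NormedAddCommGroup E] [NormedSpace ℝ E]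
    {f : (Fin 2 → ℝ) → E} (h : IsPrincipalFrame S W X Y) (hf : SmoothOn W f) :
    SmoothOn W (alongD X f) := hf.alongD h.isOpen h.smooth_left

lemma smooth_alongD_right {E : Type*} [NormedAddCommGroup E] [NormedSpace ℝ E]
    {f : (Fin 2 → ℝ) → E} (h : IsPrincipalFrame S W X Y) (hf : SmoothOn W f) :
    SmoothOn W (alongD Y f) := hf.alongD h.isOpen h.smooth_right

lemma alongD_exp_chi (h : IsPrincipalFrame S W X Y) (hy : y ∈ W)
    (Z : (Fin 2 → ℝ) → (Fin 2 → ℝ)) :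
    alongD Z (fun z => exp (chiFun S z)) y = exp (chiFun S y) * alongD Z (chiFun S) y := by
  rw [alongD_comp (by fun_prop) (h.smooth_chi.differentiableAt h.isOpen hy), Real.deriv_exp]

lemma alongD_exp_neg_chi (h : IsPrincipalFrame S W X Y) (hy : y ∈ W)
    (Z : (Fin 2 → ℝ) → (Fin 2 → ℝ)) :
    alongD Z (fun z => exp (-chiFun S z)) y = -exp (-chiFun S y) * alongD Z (chiFun S) y := by
  rw [alongD_comp (k := fun t => exp (-t)) (by fun_prop)
    (h.smooth_chi.differentiableAt h.isOpen hy)]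
  have := ((hasDerivAt_id (chiFun S y)).neg.exp).deriv
  simp only [Pi.neg_apply, id] at this
  rw [this]; ring

/-- Differentiating the squared norm of the first frame vector. -/
lemma qform_alongD_left (h : IsPrincipalFrame S W X Y) (hy : y ∈ W)
    (Z : (Fin 2 → ℝ) → (Fin 2 → ℝ)) :
    2 * qform (alongD Z (alongD X S.emb) y) (alongD X S.emb y)
      = exp (chiFun S y) * alongD Z (chiFun S) y := by
  have d := (h.smooth_alongD_left h.smooth_emb).differentiableAt h.isOpen hy
  rw [← h.alongD_exp_chi hy Z, ← alongD_congr h.isOpen h.norm_left hy, alongD_qform d d,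
    qform_comm (alongD X S.emb y)]
  ring

/-- Differentiating the squared norm of the second frame vector. -/
lemma qform_alongD_right (h : IsPrincipalFrame S W X Y) (hy : y ∈ W)
    (Z : (Fin 2 → ℝ) → (Fin 2 → ℝ)) :
    2 * qform (alongD Z (alongD Y S.emb) y) (alongD Y S.emb y)
      = exp (chiFun S y) * alongD Z (chiFun S) y := by
  have d := (h.smooth_alongD_right h.smooth_emb).differentiableAt h.isOpen hy
  rw [← h.alongD_exp_chi hy Z, ← alongD_congr h.isOpen h.norm_right hy, alongD_qform d d,
    qform_comm (alongD Y S.emb y)]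
  ring

lemma qform_alongD_add (h : IsPrincipalFrame S W X Y) (hy : y ∈ W)
    (Z : (Fin 2 → ℝ) → (Fin 2 → ℝ)) :
    qform (alongD Z (alongD X S.emb) y) (alongD Y S.emb y)
      + qform (alongD Z (alongD Y S.emb) y) (alongD X S.emb y) = 0 := by
  have dX := (h.smooth_alongD_left h.smooth_emb).differentiableAt h.isOpen hy
  have dY := (h.smooth_alongD_right h.smooth_emb).differentiableAt h.isOpen hy
  rw [← alongD_eq_zero_of_eqOn_const (X := Z) h.isOpen h.orth hy, alongD_qform dX dY,
    qform_comm (alongD X S.emb y)]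

lemma alongD_normal_left (h : IsPrincipalFrame S W X Y) (hy : y ∈ W) :
    alongD X S.normal y = exp (-chiFun S y) • alongD X S.emb y := by
  simp only [alongD, S.shape_spec, h.shape_left y hy, map_smul]

lemma alongD_normal_right (h : IsPrincipalFrame S W X Y) (hy : y ∈ W) :
    alongD Y S.normal y = (-exp (-chiFun S y)) • alongD Y S.emb y := by
  simp only [alongD, S.shape_spec, h.shape_right y hy, map_neg, map_smul, neg_smul]

/-- The Codazzi equation: the fields of a conformal principal frame commute. -/
lemma lieBracket_eq_zero (h : IsPrincipalFrame S W X Y) (hy : y ∈ W) :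
    lieBracket ℝ X Y y = 0 := by
  obtain ⟨a, b, hab⟩ := h.exists_eq_smul_add_smul hy (lieBracket ℝ X Y y)
  have hemb := alongD_lieBracket h.isOpen h.smooth_emb h.smooth_left h.smooth_right hy
  have hnor := alongD_lieBracket h.isOpen (S.smooth_normal.contDiffOn (s := W)) h.smooth_left
    h.smooth_right hy
  have dX := (h.smooth_alongD_left h.smooth_emb).differentiableAt h.isOpen hy
  have dY := (h.smooth_alongD_right h.smooth_emb).differentiableAt h.isOpen hy
  have dchi := h.smooth_chi.differentiableAt h.isOpen hy
  have hneg : alongD X (fun z => -exp (-chiFun S z)) y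
      = -alongD X (fun z => exp (-chiFun S z)) y := by
    simp [alongD, fderiv_fun_neg]
  rw [alongD_congr h.isOpen (fun z hz => h.alongD_normal_right hz) hy,
    alongD_congr h.isOpen (fun z hz => h.alongD_normal_left hz) hy,
    alongD_smul (by fun_prop) dY, alongD_smul (by fun_prop) dX, hneg,
    h.alongD_exp_neg_chi hy, h.alongD_exp_neg_chi hy, S.shape_spec, hab, map_add, map_smul,
    map_smul, h.shape_left y hy, h.shape_right y hy, map_add, map_smul, map_smul, map_smul,
    map_neg, map_smul] at hnor
  rw [hab, map_add, map_smul, map_smul] at hemb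
  have hXX := h.norm_left y hy
  have hYY := h.norm_right y hy
  have hXY := h.orth y hy
  have hYX := hXY
  rw [qform_comm] at hYX
  have hX := h.qform_alongD_left hy Y
  have hY := h.qform_alongD_right hy X
  have hr := exp_pos (chiFun S y)
  have hl := exp_pos (-chiFun S y)
  have e1 := congrArg (fun v => qform v (alongD X S.emb y)) hemb
  have e2 := congrArg (fun v => qform v (alongD Y S.emb y)) hemb
  have n1 := congrArg (fun v => qform v (alongD X S.emb y)) hnor
  have n2 := congrArg (fun v => qform v (alongD Y S.emb y)) hnor
  change qform (a • alongD X S.emb y + b • alongD Y S.emb y) _ = _ at e1 e2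
  change qform (a • exp (-chiFun S y) • alongD X S.emb y
    + b • -(exp (-chiFun S y) • alongD Y S.emb y)) _ = _ at n1 n2
  simp only [← neg_smul, sub_eq_add_neg, qform_add_left, qform_smul_left, ← neg_one_smul ℝ
    (alongD Y (alongD X S.emb) y), neg_add, hXX, hYY, hXY, hYX] at e1 e2 n1 n2
  have ha : 2 * a * (exp (-chiFun S y) * exp (chiFun S y)) = 0 := by
    linear_combination n1 + exp (-chiFun S y) * e1 - exp (-chiFun S y) * hX
  have hb : 2 * b * (exp (-chiFun S y) * exp (chiFun S y)) = 0 := by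
    linear_combination -n2 + exp (-chiFun S y) * e2 + exp (-chiFun S y) * hY
  have ha0 : a = 0 := by simpa using ha
  have hb0 : b = 0 := by simpa using hb
  rw [hab, ha0, hb0]
  simp

lemma alongD_comm {E : Type*} [NormedAddCommGroup E] [NormedSpace ℝ E]
    {f : (Fin 2 → ℝ) → E} (h : IsPrincipalFrame S W X Y) (hf : SmoothOn W f) :
    EqOn (alongD X (alongD Y f)) (alongD Y (alongD X f)) W := fun y hy => by
  have := alongD_lieBracket h.isOpen hf h.smooth_left h.smooth_right hy
  rw [h.lieBracket_eq_zero hy, map_zero] at this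
  exact (sub_eq_zero.mp this.symm)

end IsPrincipalFrame

/-! ### The Gauss equation -/

lemma qform_emb_alongD (S : SpacelikeSurface) (Z : (Fin 2 → ℝ) → (Fin 2 → ℝ)) (y : Fin 2 → ℝ) :
    qform (S.emb y) (alongD Z S.emb y) = 0 := by
  have d := S.smooth_emb.differentiable (by simp) y
  have := alongD_eq_zero_of_eqOn_const (X := Z) isOpen_univ (fun z _ => S.on_quadric z)
    (mem_univ y)
  rw [alongD_qform d d, qform_comm] at this
  linarith

lemma qform_alongD_alongD_emb (S : SpacelikeSurface) {W : Set (Fin 2 → ℝ)} (hW : IsOpen W)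
    {V : (Fin 2 → ℝ) → (Fin 2 → ℝ)} (hV : SmoothOn W V) (Z : (Fin 2 → ℝ) → (Fin 2 → ℝ))
    {y : Fin 2 → ℝ} (hy : y ∈ W) :
    qform (alongD Z (alongD V S.emb) y) (S.emb y)
      = -qform (alongD V S.emb y) (alongD Z S.emb y) := by
  have hemb : SmoothOn W S.emb := S.smooth_emb.contDiffOn
  have := alongD_eq_zero_of_eqOn_const (X := Z) hW (fun z _ => qform_emb_alongD S V z) hy
  rw [alongD_qform (hemb.differentiableAt hW hy) ((hemb.alongD hW hV).differentiableAt hW hy),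
    qform_comm, qform_comm (S.emb y)] at this
  linarith

lemma qform_alongD_alongD_normal (S : SpacelikeSurface) {W : Set (Fin 2 → ℝ)} (hW : IsOpen W)
    {V : (Fin 2 → ℝ) → (Fin 2 → ℝ)} (hV : SmoothOn W V) (Z : (Fin 2 → ℝ) → (Fin 2 → ℝ))
    {y : Fin 2 → ℝ} (hy : y ∈ W) :
    qform (alongD Z (alongD V S.emb) y) (S.normal y)
      = -qform (alongD V S.emb y) (alongD Z S.normal y) := by
  have hemb : SmoothOn W S.emb := S.smooth_emb.contDiffOn
  have hnor : SmoothOn W S.normal := S.smooth_normal.contDiffOn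
  have := alongD_eq_zero_of_eqOn_const (X := Z) (f := fun z => qform (S.normal z)
    (alongD V S.emb z)) hW (fun z _ => S.normal_orth z _) hy
  rw [alongD_qform (hnor.differentiableAt hW hy) ((hemb.alongD hW hV).differentiableAt hW hy),
    qform_comm, qform_comm (S.normal y)] at this
  linarith

namespace IsPrincipalFrame

variable {S : SpacelikeSurface} {W : Set (Fin 2 → ℝ)} {X Y : (Fin 2 → ℝ) → (Fin 2 → ℝ)}
  {y : Fin 2 → ℝ}

lemma qform_eq (h : IsPrincipalFrame S W X Y) (hy : y ∈ W) (u v : Fin 4 → ℝ) :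
    qform u v = (exp (chiFun S y))⁻¹
        * (qform u (alongD X S.emb y) * qform v (alongD X S.emb y)
          + qform u (alongD Y S.emb y) * qform v (alongD Y S.emb y))
      - qform u (S.emb y) * qform v (S.emb y) - qform u (S.normal y) * qform v (S.normal y) :=
  qform_eq_of_orthogonal (exp_pos _).ne' (h.norm_left y hy) (h.norm_right y hy) (h.orth y hy)
    (S.on_quadric y) (S.normal_unit y) (S.normal_orth_base y) (qform_emb_alongD S X y)
    (qform_emb_alongD S Y y) (S.normal_orth y _) (S.normal_orth y _) u v

lemma alongD_alongD_exp_chi (h : IsPrincipalFrame S W X Y) (hy : y ∈ W)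
    {Z : (Fin 2 → ℝ) → (Fin 2 → ℝ)} (hZ : SmoothOn W Z) :
    alongD Z (alongD Z fun z => exp (chiFun S z)) y
      = exp (chiFun S y) * (alongD Z (chiFun S) y ^ 2 + alongD Z (alongD Z (chiFun S)) y) := by
  have dchi := h.smooth_chi.differentiableAt h.isOpen hy
  rw [alongD_congr h.isOpen (fun z hz => h.alongD_exp_chi hz Z) hy,
    alongD_mul (by fun_prop) ((h.smooth_chi.alongD h.isOpen hZ).differentiableAt h.isOpen hy),
    h.alongD_exp_chi hy Z]
  ring

/-- The flat Laplacian of the conformal factor, by commuting derivatives of the embedding. -/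
lemma alongD_alongD_exp_chi_add (h : IsPrincipalFrame S W X Y) (hy : y ∈ W) :
    alongD X (alongD X fun z => exp (chiFun S z)) y
        + alongD Y (alongD Y fun z => exp (chiFun S z)) y
      = 2 * (qform (alongD Y (alongD X S.emb) y) (alongD Y (alongD X S.emb) y)
        - qform (alongD X (alongD X S.emb) y) (alongD Y (alongD Y S.emb) y)) := by
  have sX := h.smooth_alongD_left h.smooth_emb
  have sY := h.smooth_alongD_right h.smooth_emb
  have sYX := h.smooth_alongD_right sX
  have sYY := h.smooth_alongD_right sY
  have hX : EqOn (alongD X fun z => exp (chiFun S z))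
      (fun z => (-2) * qform (alongD Y (alongD Y S.emb) z) (alongD X S.emb z)) W := by
    intro z hz
    have h1 := h.qform_alongD_right hz X
    have h2 := h.qform_alongD_add hz Y
    rw [h.alongD_comm h.smooth_emb hz] at h1
    rw [h.alongD_exp_chi hz X]
    linarith
  have hY : EqOn (alongD Y fun z => exp (chiFun S z))
      (fun z => 2 * qform (alongD Y (alongD X S.emb) z) (alongD X S.emb z)) W := by
    intro z hz
    rw [h.alongD_exp_chi hz Y]
    exact (h.qform_alongD_left hz Y).symm
  have hcomm : alongD X (alongD Y (alongD Y S.emb)) y = alongD Y (alongD Y (alongD X S.emb)) y := by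
    rw [h.alongD_comm sY hy, alongD_congr h.isOpen (h.alongD_comm h.smooth_emb) hy]
  have dc : ∀ c : ℝ, DifferentiableAt ℝ (fun _ : Fin 2 → ℝ => c) y := fun c => by fun_prop
  have dcz : ∀ (c : ℝ) (Z : (Fin 2 → ℝ) → (Fin 2 → ℝ)),
      alongD Z (fun _ : Fin 2 → ℝ => c) y = 0 := fun c Z => by simp [alongD]
  rw [alongD_congr h.isOpen hX hy, alongD_congr h.isOpen hY hy,
    alongD_mul (dc _) ((sYY.qform sX).differentiableAt h.isOpen hy),
    alongD_mul (dc _) ((sYX.qform sX).differentiableAt h.isOpen hy), dcz, dcz,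
    alongD_qform (sYY.differentiableAt h.isOpen hy) (sX.differentiableAt h.isOpen hy),
    alongD_qform (sYX.differentiableAt h.isOpen hy) (sX.differentiableAt h.isOpen hy), hcomm,
    qform_comm (alongD Y (alongD Y S.emb) y) (alongD X (alongD X S.emb) y)]
  ring

/-- In a conformal principal frame, the Gauss equation is the sinh-Gordon equation. -/
lemma alongD_alongD_chi_add (h : IsPrincipalFrame S W X Y) (hy : y ∈ W) :
    alongD X (alongD X (chiFun S)) y + alongD Y (alongD Y (chiFun S)) y
      = 2 * (exp (chiFun S y) - exp (-chiFun S y)) := by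
  have key := h.alongD_alongD_exp_chi_add hy
  rw [h.alongD_alongD_exp_chi hy h.smooth_left, h.alongD_alongD_exp_chi hy h.smooth_right,
    h.qform_eq hy (alongD Y (alongD X S.emb) y), h.qform_eq hy (alongD X (alongD X S.emb) y),
    qform_alongD_alongD_emb S h.isOpen h.smooth_left Y hy,
    qform_alongD_alongD_emb S h.isOpen h.smooth_left X hy,
    qform_alongD_alongD_emb S h.isOpen h.smooth_right Y hy,
    qform_alongD_alongD_normal S h.isOpen h.smooth_left Y hy,
    qform_alongD_alongD_normal S h.isOpen h.smooth_left X hy,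
    qform_alongD_alongD_normal S h.isOpen h.smooth_right Y hy,
    h.alongD_normal_left hy, h.alongD_normal_right hy, qform_smul_right, qform_smul_right,
    qform_smul_right, h.norm_left y hy, h.norm_right y hy, h.orth y hy] at key
  have hXX := h.qform_alongD_left hy X
  have hYX := h.qform_alongD_left hy Y
  have hXY := h.qform_alongD_right hy X
  have hYY := h.qform_alongD_right hy Y
  have oX := h.qform_alongD_add hy X
  have oY := h.qform_alongD_add hy Y
  rw [h.alongD_comm h.smooth_emb hy] at hXY oX
  have e1 : qform (alongD X (alongD X S.emb) y) (alongD X S.emb y)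
      = exp (chiFun S y) * alongD X (chiFun S) y / 2 := by linarith
  have e2 : qform (alongD Y (alongD X S.emb) y) (alongD X S.emb y)
      = exp (chiFun S y) * alongD Y (chiFun S) y / 2 := by linarith
  have e3 : qform (alongD Y (alongD X S.emb) y) (alongD Y S.emb y)
      = exp (chiFun S y) * alongD X (chiFun S) y / 2 := by linarith
  have e4 : qform (alongD Y (alongD Y S.emb) y) (alongD Y S.emb y)
      = exp (chiFun S y) * alongD Y (chiFun S) y / 2 := by linarith
  have e5 : qform (alongD X (alongD X S.emb) y) (alongD Y S.emb y)
      = -(exp (chiFun S y) * alongD Y (chiFun S) y / 2) := by linarith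
  have e6 : qform (alongD Y (alongD Y S.emb) y) (alongD X S.emb y)
      = -(exp (chiFun S y) * alongD X (chiFun S) y / 2) := by linarith
  rw [e1, e2, e3, e4, e5, e6, exp_neg] at key
  rw [exp_neg]
  have hr := (exp_pos (chiFun S y)).ne'
  field_simp at key ⊢
  refine mul_left_cancel₀ (pow_ne_zero 2 hr) ?_
  linear_combination key / 2

end IsPrincipalFrame

/-! ### Gradient and Laplacian in a principal frame -/

namespace IsPrincipalFrame

variable {S : SpacelikeSurface} {W : Set (Fin 2 → ℝ)} {X Y : (Fin 2 → ℝ) → (Fin 2 → ℝ)}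
  {y : Fin 2 → ℝ} {f : (Fin 2 → ℝ) → ℝ} {F : (Fin 2 → ℝ) → (Fin 2 → ℝ)}

lemma alongD_gradient (h : IsPrincipalFrame S W X Y) (hF : S.IsGradientOn S.nonUmbilic f F)
    (hy : y ∈ W) :
    alongD F S.emb y = (exp (-chiFun S y) * alongD X f y) • alongD X S.emb y
      + (exp (-chiFun S y) * alongD Y f y) • alongD Y S.emb y := by
  obtain ⟨a, b, hab⟩ := h.exists_eq_smul_add_smul hy (F y)
  have hG : alongD F S.emb y = a • alongD X S.emb y + b • alongD Y S.emb y := by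
    simp only [alongD, hab, map_add, map_smul]
  have hYX := h.orth y hy
  rw [qform_comm] at hYX
  have hX : qform (alongD F S.emb y) (alongD X S.emb y) = alongD X f y :=
    hF y (h.subset hy) (X y)
  have hY : qform (alongD F S.emb y) (alongD Y S.emb y) = alongD Y f y :=
    hF y (h.subset hy) (Y y)
  rw [hG, qform_add_left, qform_smul_left, qform_smul_left, h.norm_left y hy, hYX] at hX
  rw [hG, qform_add_left, qform_smul_left, qform_smul_left, h.norm_right y hy, h.orth y hy] at hY
  have he : exp (-chiFun S y) * exp (chiFun S y) = 1 := by rw [← exp_add]; simp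
  rw [hG, ← hX, ← hY]
  congr 2 <;> linear_combination (-_) * he

lemma gradNormSq_eq (h : IsPrincipalFrame S W X Y) (hF : S.IsGradientOn S.nonUmbilic f F)
    (hy : y ∈ W) :
    S.gradNormSq F y = exp (-chiFun S y) * (alongD X f y ^ 2 + alongD Y f y ^ 2) := by
  have hYX := h.orth y hy
  rw [qform_comm] at hYX
  change qform (alongD F S.emb y) (alongD F S.emb y) = _
  rw [h.alongD_gradient hF hy]
  simp only [qform_add_left, qform_add_right, qform_smul_left, qform_smul_right,
    h.norm_left y hy, h.norm_right y hy, h.orth y hy, hYX]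
  have he : exp (-chiFun S y) * exp (chiFun S y) = 1 := by rw [← exp_add]; simp
  linear_combination exp (-chiFun S y) * (alongD X f y ^ 2 + alongD Y f y ^ 2) * he

lemma qform_hessian {H : (Fin 2 → ℝ) → ((Fin 2 → ℝ) →ₗ[ℝ] (Fin 2 → ℝ))}
    (hH : S.IsHessianOn S.nonUmbilic F H) (hy : y ∈ S.nonUmbilic)
    (Z V : (Fin 2 → ℝ) → (Fin 2 → ℝ)) :
    qform (alongD Z (alongD F S.emb) y) (alongD V S.emb y)
      = qform (fderiv ℝ S.emb y (H y (Z y))) (alongD V S.emb y) := by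
  obtain ⟨a, b, hab⟩ := hH y hy (Z y)
  change alongD Z (alongD F S.emb) y = _ at hab
  have hN : qform (S.normal y) (alongD V S.emb y) = 0 := S.normal_orth y _
  rw [hab, qform_add_left, qform_add_left, qform_smul_left, qform_smul_left,
    qform_emb_alongD, hN]
  ring

/-- The Laplacian is `exp (-χ)` times the flat Laplacian of the conformal frame. -/
lemma trace_hessian_eq (h : IsPrincipalFrame S W X Y) (hf : SmoothOn W f)
    (hF : S.IsGradientOn S.nonUmbilic f F)
    {H : (Fin 2 → ℝ) → ((Fin 2 → ℝ) →ₗ[ℝ] (Fin 2 → ℝ))}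
    (hH : S.IsHessianOn S.nonUmbilic F H) (hy : y ∈ W) :
    LinearMap.trace ℝ (Fin 2 → ℝ) (H y)
      = exp (-chiFun S y) * (alongD X (alongD X f) y + alongD Y (alongD Y f) y) := by
  have dX := (h.smooth_alongD_left h.smooth_emb).differentiableAt h.isOpen hy
  have dY := (h.smooth_alongD_right h.smooth_emb).differentiableAt h.isOpen hy
  have dfX := (h.smooth_alongD_left hf).differentiableAt h.isOpen hy
  have dfY := (h.smooth_alongD_right hf).differentiableAt h.isOpen hy
  have dchi := h.smooth_chi.differentiableAt h.isOpen hy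
  have de : DifferentiableAt ℝ (fun z => exp (-chiFun S z)) y := by fun_prop
  have hG : ∀ Z, alongD Z (alongD F S.emb) y
      = (((-exp (-chiFun S y) * alongD Z (chiFun S) y) * alongD X f y
          + exp (-chiFun S y) * alongD Z (alongD X f) y) • alongD X S.emb y
        + (exp (-chiFun S y) * alongD X f y) • alongD Z (alongD X S.emb) y)
      + (((-exp (-chiFun S y) * alongD Z (chiFun S) y) * alongD Y f y
          + exp (-chiFun S y) * alongD Z (alongD Y f) y) • alongD Y S.emb y
        + (exp (-chiFun S y) * alongD Y f y) • alongD Z (alongD Y S.emb) y) := fun Z => by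
    rw [alongD_congr h.isOpen (fun z hz => h.alongD_gradient hF hz) hy,
      alongD_add ((de.fun_mul dfX).fun_smul dX) ((de.fun_mul dfY).fun_smul dY),
      alongD_smul (de.fun_mul dfX) dX, alongD_smul (de.fun_mul dfY) dY,
      alongD_mul de dfX, alongD_mul de dfY, h.alongD_exp_neg_chi hy]
  have hYX := h.orth y hy
  rw [qform_comm] at hYX
  obtain ⟨a, b, hab⟩ := h.exists_eq_smul_add_smul hy (H y (X y))
  obtain ⟨c, d, hcd⟩ := h.exists_eq_smul_add_smul hy (H y (Y y))
  have hX := qform_hessian hH (h.subset hy) X X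
  have hY := qform_hessian hH (h.subset hy) Y Y
  rw [h.trace_eq hy hab hcd]
  rw [hab, map_add, map_smul, map_smul] at hX
  rw [hcd, map_add, map_smul, map_smul] at hY
  change _ = qform (a • alongD X S.emb y + b • alongD Y S.emb y) _ at hX
  change _ = qform (c • alongD X S.emb y + d • alongD Y S.emb y) _ at hY
  simp only [hG, qform_add_left, qform_smul_left, h.norm_left y hy, h.norm_right y hy,
    h.orth y hy, hYX] at hX hY
  have hXX := h.qform_alongD_left hy X
  have hYX' := h.qform_alongD_left hy Y
  have hXY' := h.qform_alongD_right hy X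
  have hYY := h.qform_alongD_right hy Y
  rw [h.alongD_comm h.smooth_emb hy] at hXY' hX
  refine mul_right_cancel₀ (exp_pos (chiFun S y)).ne' ?_
  linear_combination -hX - hY + exp (-chiFun S y) * alongD X f y / 2 * (hXX + hXY')
    + exp (-chiFun S y) * alongD Y f y / 2 * (hYX' + hYY)

end IsPrincipalFrame

/-! ### Existence of conformal principal frames -/

namespace SpacelikeSurface

variable (S : SpacelikeSurface)

lemma shape_symm (y v w : Fin 2 → ℝ) :
    qform (fderiv ℝ S.emb y (S.shape y v)) (fderiv ℝ S.emb y w)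
      = qform (fderiv ℝ S.emb y v) (fderiv ℝ S.emb y (S.shape y w)) := by
  have smooth_const : ∀ u : Fin 2 → ℝ, SmoothOn univ fun _ : Fin 2 → ℝ => u :=
    fun u => contDiffOn_const
  have key := alongD_lieBracket isOpen_univ S.smooth_emb.contDiffOn (smooth_const v)
    (smooth_const w) (mem_univ y)
  have hvw := qform_alongD_alongD_normal S isOpen_univ (smooth_const v) (fun _ => w) (mem_univ y)
  have hwv := qform_alongD_alongD_normal S isOpen_univ (smooth_const w) (fun _ => v) (mem_univ y)
  rw [show lieBracket ℝ (fun _ : Fin 2 → ℝ => v) (fun _ => w) y = 0 by simp [lieBracket],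
    map_zero] at key
  rw [sub_eq_zero.mp key.symm, hvw] at hwv
  simp only [alongD, S.shape_spec] at hwv
  rw [qform_comm]
  linarith

lemma gram_pos (y : Fin 2 → ℝ) :
    0 < qform (fderiv ℝ S.emb y (Pi.single 0 1)) (fderiv ℝ S.emb y (Pi.single 0 1))
        * qform (fderiv ℝ S.emb y (Pi.single 1 1)) (fderiv ℝ S.emb y (Pi.single 1 1))
      - qform (fderiv ℝ S.emb y (Pi.single 0 1)) (fderiv ℝ S.emb y (Pi.single 1 1)) ^ 2 := by
  have hE := S.spacelike y (Pi.single 0 1) (by simp)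
  set u := fderiv ℝ S.emb y (Pi.single 0 1) with hu
  set w := fderiv ℝ S.emb y (Pi.single 1 1) with hw
  have hne : (qform u w) • (Pi.single 0 1 : Fin 2 → ℝ) + (-qform u u) • Pi.single 1 1 ≠ 0 :=
    fun h => hE.ne' (by simpa using congrFun h 1)
  have := S.spacelike y _ hne
  simp only [map_add, map_smul, ← hu, ← hw, qform_add_left, qform_add_right, qform_smul_left,
    qform_smul_right, qform_comm w u] at this
  refine pos_of_mul_pos_right (a := qform u u) ?_ hE.le
  linarith

lemma eq_smul_single (v : Fin 2 → ℝ) :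
    v = v 0 • (Pi.single 0 1 : Fin 2 → ℝ) + v 1 • Pi.single 1 1 := by
  ext i; fin_cases i <;> simp

lemma contDiff_shape (v : Fin 2 → ℝ) : ContDiff ℝ (⊤ : ℕ∞) fun y => S.shape y v := by
  have hemb : SmoothOn univ S.emb := S.smooth_emb.contDiffOn
  have hnor : SmoothOn univ S.normal := S.smooth_normal.contDiffOn
  have hconst : ∀ u : Fin 2 → ℝ, SmoothOn univ fun _ : Fin 2 → ℝ => u := fun u => contDiffOn_const
  have sE := fun u => hemb.alongD isOpen_univ (hconst u)
  have sN := hnor.alongD isOpen_univ (hconst v)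
  have sq := fun u w => (sE u).qform (sE w)
  have sp := fun u => sN.qform (sE u)
  have hpos := fun y => (S.gram_pos y).ne'
  have hD := ((sq (Pi.single 0 1) (Pi.single 0 1)).mul (sq (Pi.single 1 1) (Pi.single 1 1))).sub
    ((sq (Pi.single 0 1) (Pi.single 1 1)).pow 2)
  have h0 := (((sp (Pi.single 0 1)).mul (sq (Pi.single 1 1) (Pi.single 1 1))).sub
    ((sp (Pi.single 1 1)).mul (sq (Pi.single 0 1) (Pi.single 1 1)))).div hD (fun y _ => hpos y)
  have h1 := (((sp (Pi.single 1 1)).mul (sq (Pi.single 0 1) (Pi.single 0 1))).sub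
    ((sp (Pi.single 0 1)).mul (sq (Pi.single 0 1) (Pi.single 1 1)))).div hD (fun y _ => hpos y)
  have hN : ∀ y, fderiv ℝ S.normal y v
      = S.shape y v 0 • fderiv ℝ S.emb y (Pi.single 0 1)
        + S.shape y v 1 • fderiv ℝ S.emb y (Pi.single 1 1) := fun y => by
    rw [S.shape_spec, ← map_smul, ← map_smul, ← map_add, ← eq_smul_single]
  rw [contDiff_pi]
  intro i
  rw [← contDiffOn_univ]
  fin_cases i
  · refine h0.congr fun y _ => ?_
    simp only [Fin.zero_eta, Pi.div_apply, alongD]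
    rw [eq_div_iff (hpos y)]
    simp only [hN, qform_add_left, qform_smul_left, qform_comm
      (fderiv ℝ S.emb y (Pi.single 1 1)) (fderiv ℝ S.emb y (Pi.single 0 1))]
    ring
  · refine h1.congr fun y _ => ?_
    simp only [Fin.mk_one, Pi.div_apply, alongD]
    rw [eq_div_iff (hpos y)]
    simp only [hN, qform_add_left, qform_smul_left, qform_comm
      (fderiv ℝ S.emb y (Pi.single 1 1)) (fderiv ℝ S.emb y (Pi.single 0 1))]
    ring

lemma det_shape (y : Fin 2 → ℝ) :
    LinearMap.det (S.shape y)
      = S.shape y (Pi.single 0 1) 0 * S.shape y (Pi.single 1 1) 1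
        - S.shape y (Pi.single 1 1) 0 * S.shape y (Pi.single 0 1) 1 := by
  rw [← LinearMap.det_toMatrix', Matrix.det_fin_two]
  simp [LinearMap.toMatrix'_apply]

lemma trace_shape (y : Fin 2 → ℝ) :
    LinearMap.trace ℝ (Fin 2 → ℝ) (S.shape y)
      = S.shape y (Pi.single 0 1) 0 + S.shape y (Pi.single 1 1) 1 := by
  rw [LinearMap.trace_eq_matrix_trace ℝ (Pi.basisFun ℝ (Fin 2)), Matrix.trace_fin_two]
  simp

lemma contDiff_det_shape : ContDiff ℝ (⊤ : ℕ∞) fun y => LinearMap.det (S.shape y) := by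
  have hs := fun v => contDiff_pi.mp (S.contDiff_shape v)
  simp only [det_shape]
  exact ((hs _ 0).mul (hs _ 1)).sub ((hs _ 0).mul (hs _ 1))

lemma isOpen_nonUmbilic : IsOpen S.nonUmbilic :=
  isOpen_ne_fun S.contDiff_det_shape.continuous continuous_const

variable {S}

lemma IsMaximal.shape_shape (hmax : S.IsMaximal) (y v : Fin 2 → ℝ) :
    S.shape y (S.shape y v) = (-LinearMap.det (S.shape y)) • v := by
  have hdec : ∀ u, S.shape y u
      = u 0 • S.shape y (Pi.single 0 1) + u 1 • S.shape y (Pi.single 1 1) := fun u => by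
    rw [← map_smul, ← map_smul, ← map_add, ← eq_smul_single]
  have htr := hmax y
  rw [trace_shape] at htr
  rw [hdec (S.shape y v), hdec v, det_shape]
  ext i
  fin_cases i <;> simp only [Fin.zero_eta, Fin.mk_one, Pi.add_apply, Pi.smul_apply, smul_eq_mul]
  · linear_combination (v 0 * S.shape y (Pi.single 0 1) 0 + v 1 * S.shape y (Pi.single 1 1) 0) * htr
  · linear_combination (v 0 * S.shape y (Pi.single 0 1) 1 + v 1 * S.shape y (Pi.single 1 1) 1) * htr

lemma IsMaximal.neg_det_pos (hmax : S.IsMaximal) {y : Fin 2 → ℝ} (hy : y ∈ S.nonUmbilic) :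
    0 < -LinearMap.det (S.shape y) := by
  have hB : S.shape y (Pi.single 0 1) ≠ 0 := fun h => hy (by simp [det_shape, h])
  have h1 := S.spacelike y _ hB
  rw [shape_symm, hmax.shape_shape, map_smul, qform_smul_right] at h1
  exact pos_of_mul_pos_left h1 (S.spacelike y (Pi.single 0 1) (by simp)).le

lemma IsMaximal.lambdaAt_pos (hmax : S.IsMaximal) {y : Fin 2 → ℝ} (hy : y ∈ S.nonUmbilic) :
    0 < S.lambdaAt y := Real.sqrt_pos.mpr (hmax.neg_det_pos hy)

lemma IsMaximal.shape_shape_eq_lambdaAt_sq (hmax : S.IsMaximal) {y : Fin 2 → ℝ}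
    (hy : y ∈ S.nonUmbilic) (v : Fin 2 → ℝ) :
    S.shape y (S.shape y v) = (S.lambdaAt y * S.lambdaAt y) • v := by
  rw [hmax.shape_shape, lambdaAt, Real.mul_self_sqrt (hmax.neg_det_pos hy).le]

lemma IsMaximal.smooth_lambdaAt (hmax : S.IsMaximal) : SmoothOn S.nonUmbilic S.lambdaAt :=
  S.contDiff_det_shape.neg.contDiffOn.sqrt fun _ hy => (hmax.neg_det_pos hy).ne'

lemma IsMaximal.smooth_chiFun (hmax : S.IsMaximal) : SmoothOn S.nonUmbilic (chiFun S) :=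
  (hmax.smooth_lambdaAt.log fun _ hy => (hmax.lambdaAt_pos hy).ne').neg

lemma IsMaximal.exp_neg_chiFun (hmax : S.IsMaximal) {y : Fin 2 → ℝ} (hy : y ∈ S.nonUmbilic) :
    exp (-chiFun S y) = S.lambdaAt y := by
  rw [chiFun, neg_neg, exp_log (hmax.lambdaAt_pos hy)]

/-- A nowhere vanishing field can be rescaled to have squared norm `exp χ`. -/
lemma exists_rescale {W : Set (Fin 2 → ℝ)} (hW : IsOpen W) (hchi : SmoothOn W (chiFun S))
    {V : (Fin 2 → ℝ) → (Fin 2 → ℝ)} (hV : SmoothOn W V) (hne : ∀ y ∈ W, V y ≠ 0) :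
    ∃ c : (Fin 2 → ℝ) → ℝ, SmoothOn W c ∧ ∀ y ∈ W,
      qform (alongD (fun z => c z • V z) S.emb y) (alongD (fun z => c z • V z) S.emb y)
        = exp (chiFun S y) := by
  have hemb : SmoothOn W (alongD V S.emb) :=
    SmoothOn.alongD (S.smooth_emb.contDiffOn (s := W)) hW hV
  have hpos : ∀ y ∈ W, 0 < qform (alongD V S.emb y) (alongD V S.emb y) :=
    fun y hy => S.spacelike y _ (hne y hy)
  refine ⟨fun y => √(exp (chiFun S y) / qform (alongD V S.emb y) (alongD V S.emb y)),
    (hchi.exp.div (hemb.qform hemb) fun y hy => (hpos y hy).ne').sqrt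
      fun y hy => (div_pos (exp_pos _) (hpos y hy)).ne', fun y hy => ?_⟩
  have hs := Real.mul_self_sqrt (div_pos (exp_pos (chiFun S y)) (hpos y hy)).le
  simp only [alongD, map_smul, qform_smul_left, qform_smul_right] at hs hpos ⊢
  rw [← mul_assoc, hs, div_mul_cancel₀ _ (hpos y hy).ne']

/-- Around each non-umbilical point of a maximal surface there is a conformal principal frame. -/
lemma IsMaximal.exists_isPrincipalFrame (hmax : S.IsMaximal) {y₀ : Fin 2 → ℝ}
    (hy₀ : y₀ ∈ S.nonUmbilic) :
    ∃ W X Y, y₀ ∈ W ∧ IsPrincipalFrame S W X Y := by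
  have hl₀ := hmax.lambdaAt_pos hy₀
  have htr := hmax y₀
  rw [trace_shape] at htr
  have eigen : ∀ ε : ℝ, ε ≠ 0 → ∃ v, S.shape y₀ v + ε • v ≠ 0 := by
    intro ε hε
    by_contra! hcon
    have h0 := congrFun (hcon (Pi.single 0 1)) 0
    have h1 := congrFun (hcon (Pi.single 1 1)) 1
    simp at h0 h1
    exact hε (by linarith)
  obtain ⟨v, hv⟩ := eigen _ hl₀.ne'
  obtain ⟨w, hw⟩ := eigen _ (neg_ne_zero.mpr hl₀.ne')
  set V : (Fin 2 → ℝ) → (Fin 2 → ℝ) := fun y => S.shape y v + S.lambdaAt y • v with hVdef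
  set V' : (Fin 2 → ℝ) → (Fin 2 → ℝ) := fun y => S.shape y w + (-S.lambdaAt y) • w with hVdef'
  have sV : SmoothOn S.nonUmbilic V :=
    (S.contDiff_shape v).contDiffOn.add (hmax.smooth_lambdaAt.smul contDiffOn_const)
  have sV' : SmoothOn S.nonUmbilic V' :=
    (S.contDiff_shape w).contDiffOn.add (hmax.smooth_lambdaAt.neg.smul contDiffOn_const)
  have eV : ∀ y ∈ S.nonUmbilic, S.shape y (V y) = S.lambdaAt y • V y := fun y hy => by
    simp only [hVdef, map_add, map_smul, hmax.shape_shape_eq_lambdaAt_sq hy, smul_add, smul_smul]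
    abel
  have eV' : ∀ y ∈ S.nonUmbilic, S.shape y (V' y) = -(S.lambdaAt y • V' y) := fun y hy => by
    simp only [hVdef', map_add, map_smul, hmax.shape_shape_eq_lambdaAt_sq hy]
    module
  have orth : ∀ y ∈ S.nonUmbilic,
      qform (fderiv ℝ S.emb y (V y)) (fderiv ℝ S.emb y (V' y)) = 0 := fun y hy => by
    have := S.shape_symm y (V y) (V' y)
    rw [eV y hy, eV' y hy, ← neg_smul, map_smul, map_smul, qform_smul_left, qform_smul_right]
      at this
    exact (mul_eq_zero.mp (by linarith : S.lambdaAt y * _ = 0)).resolve_left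
      (hmax.lambdaAt_pos hy).ne'
  have hWo : IsOpen ((S.nonUmbilic ∩ V ⁻¹' {0}ᶜ) ∩ (S.nonUmbilic ∩ V' ⁻¹' {0}ᶜ)) :=
    (sV.continuousOn.isOpen_inter_preimage S.isOpen_nonUmbilic isOpen_compl_singleton).inter
      (sV'.continuousOn.isOpen_inter_preimage S.isOpen_nonUmbilic isOpen_compl_singleton)
  set W := (S.nonUmbilic ∩ V ⁻¹' {0}ᶜ) ∩ (S.nonUmbilic ∩ V' ⁻¹' {0}ᶜ)
  have hWU : W ⊆ S.nonUmbilic := fun y hy => hy.1.1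
  obtain ⟨c, hc, hcn⟩ := exists_rescale hWo (hmax.smooth_chiFun.mono hWU) (sV.mono hWU)
    fun y hy => hy.1.2
  obtain ⟨d, hd, hdn⟩ := exists_rescale hWo (hmax.smooth_chiFun.mono hWU) (sV'.mono hWU)
    fun y hy => hy.2.2
  exact ⟨W, fun y => c y • V y, fun y => d y • V' y, ⟨⟨hy₀, hv⟩, hy₀, hw⟩,
    { isOpen := hWo
      subset := hWU
      smooth_chi := hmax.smooth_chiFun.mono hWU
      smooth_left := hc.smul (sV.mono hWU)
      smooth_right := hd.smul (sV'.mono hWU)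
      norm_left := hcn
      norm_right := hdn
      orth := fun y hy => by
        simp only [alongD, map_smul, qform_smul_left, qform_smul_right, orth y (hWU hy), mul_zero]
      shape_left := fun y hy => by
        rw [map_smul, eV y (hWU hy), hmax.exp_neg_chiFun (hWU hy), smul_comm]
      shape_right := fun y hy => by
        rw [map_smul, eV' y (hWU hy), hmax.exp_neg_chiFun (hWU hy), smul_neg, smul_comm] }⟩

end SpacelikeSurface

/-- **Lemma (a differential inequality).** Let `S` be a maximal surface in AdS³ with
principal curvatures `±λ` and, away from umbilical points, let `χ = −ln|λ|`.  For any
smooth `g : (0,∞) → ℝ`, the function `ψ = e^{g(χ)}·‖grad χ‖²` satisfies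
`Δ_S ψ ≥ a(χ)ψ² + b(χ)ψ + c(χ)`, where `a(χ) = g″(χ)e^{−g(χ)}`,
`b(χ) = 6g′(χ)(1 − e^{−2χ}) + (10e^{−2χ} − 2)` and `c(χ) = e^{g(χ)}(Δ_S χ)²`. -/
theorem differential_inequality_grad_chi (S : SpacelikeSurface) (hmax : S.IsMaximal)
    (g : ℝ → ℝ) (hg : ContDiff ℝ (⊤ : ℕ∞) g)
    (F : (Fin 2 → ℝ) → (Fin 2 → ℝ))
    (hF : S.IsGradientOn S.nonUmbilic (chiFun S) F)
    (lapChi lapPsi : (Fin 2 → ℝ) → ℝ)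
    (hlapChi : S.IsLaplacianOn S.nonUmbilic (chiFun S) lapChi)
    (hlapPsi : S.IsLaplacianOn S.nonUmbilic
      (fun y => Real.exp (g (chiFun S y)) * S.gradNormSq F y) lapPsi) :
    ∀ y ∈ S.nonUmbilic,
      deriv (deriv g) (chiFun S y) * Real.exp (-g (chiFun S y))
          * (Real.exp (g (chiFun S y)) * S.gradNormSq F y) ^ 2
        + (6 * deriv g (chiFun S y) * (1 - Real.exp (-(2 * chiFun S y)))
            + (10 * Real.exp (-(2 * chiFun S y)) - 2))
          * (Real.exp (g (chiFun S y)) * S.gradNormSq F y)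
        + Real.exp (g (chiFun S y)) * (lapChi y) ^ 2
      ≤ lapPsi y := by
  intro y hy
  obtain ⟨W, X, Y, hyW, h⟩ := hmax.exists_isPrincipalFrame hy
  obtain ⟨F₁, H₁, hF₁, hH₁, hlap₁⟩ := hlapChi
  obtain ⟨F₂, H₂, hF₂, hH₂, hlap₂⟩ := hlapPsi
  set ψ : (Fin 2 → ℝ) → ℝ := fun z => exp (g (chiFun S z) - chiFun S z)
    * (alongD X (chiFun S) z * alongD X (chiFun S) z
      + alongD Y (chiFun S) z * alongD Y (chiFun S) z) with hψ
  have hψW : EqOn (fun z => exp (g (chiFun S z)) * S.gradNormSq F z) ψ W := fun z hz => by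
    simp only [hψ, h.gradNormSq_eq hF hz, sub_eq_add_neg, exp_add]
    ring
  have sX := h.smooth_alongD_left h.smooth_chi
  have sY := h.smooth_alongD_right h.smooth_chi
  have sψ : SmoothOn W ψ :=
    ((hg.comp_contDiffOn h.smooth_chi).sub h.smooth_chi).exp.mul ((sX.mul sX).add (sY.mul sY))
  have key := flat_differential_inequality hg h.isOpen h.smooth_left h.smooth_right h.smooth_chi
    (fun f hf => h.alongD_comm hf) (fun z hz => h.alongD_alongD_chi_add hz) hyW hψ
    (h.gradNormSq_eq hF hyW)
  rw [hlap₁ y hy, hlap₂ y hy, h.trace_hessian_eq h.smooth_chi hF₁ hH₁ hyW,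
    h.trace_hessian_eq (sψ.congr hψW) hF₂ hH₂ hyW,
    alongD_congr h.isOpen (alongD_congr h.isOpen hψW) hyW,
    alongD_congr h.isOpen (alongD_congr h.isOpen hψW) hyW]
  exact key

end AdSPaper
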